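/- The TTF transformation R is a strictly increasing bijection from ℝ onto ℝ, and for every x ∈ ℝ the unique z ∈ ℝ with R(z) = x satisfies sign(z) = sign(x − μ) and erfc(|z|/√2) = (λ_s·|(x − μ)/σ| + 1)^(−1/λ_s), where λ_s = λ₊ if x ≥ μ and λ_s = λ₋ if x < μ. -/

import Mathlib

open MeasureTheory Real Filter

/-- The complementary error function `erfc(z) = (2/√π) ∫_z^∞ exp(-t²) dt`. -/
noncomputable def erfc (z : ℝ) : ℝ :=
  (2 / Real.sqrt Real.pi) * ∫ t in Set.Ioi z, Real.exp (-t ^ 2)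

/-- The TTF transformation `R(z) = μ + σ (s/λ_s)(erfc(|z|/√2)^(-λ_s) - 1)`, where
`s = sign(z)` (`s = 1` for `z ≥ 0`, `s = -1` for `z < 0`), `λ_s = λ₊` when `s = 1`
and `λ_s = λ₋` when `s = -1`. -/
noncomputable def ttfR (m σ lp lm z : ℝ) : ℝ :=
  if 0 ≤ z then
    m + σ * ((1 / lp) * ((erfc (|z| / Real.sqrt 2)) ^ (-lp) - 1))
  else
    m + σ * ((-1 / lm) * ((erfc (|z| / Real.sqrt 2)) ^ (-lm) - 1))

theorem aux_integrable : Integrable (fun t : ℝ => Real.exp (-t ^ 2)) := by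
  simpa using integrable_exp_neg_mul_sq (b := 1) one_pos

theorem aux_sub (a b : ℝ) :
    erfc a - erfc b = (2 / Real.sqrt Real.pi) * ∫ t in a..b, Real.exp (-t ^ 2) := by
  unfold erfc
  rw [← mul_sub, intervalIntegral.integral_Ioi_sub_Ioi' aux_integrable.integrableOn
    aux_integrable.integrableOn]

theorem aux_const_pos : 0 < 2 / Real.sqrt Real.pi := by positivity

theorem erfc_strictAnti : StrictAnti erfc := by
  intro a b hab
  rw [← sub_pos, aux_sub]
  refine mul_pos aux_const_pos ?_
  exact intervalIntegral.intervalIntegral_pos_of_pos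
    (aux_integrable.intervalIntegrable) (fun x => Real.exp_pos _) hab

theorem erfc_zero' : erfc 0 = 1 := by
  unfold erfc
  have h := integral_gaussian_Ioi 1
  simp only [neg_mul, one_mul, div_one] at h
  rw [h]
  have : Real.sqrt Real.pi ≠ 0 := by positivity
  field_simp

theorem erfc_nonneg' (a : ℝ) : 0 ≤ erfc a := by
  unfold erfc
  exact mul_nonneg aux_const_pos.le (integral_nonneg fun x => (Real.exp_pos _).le)

theorem erfc_pos' (a : ℝ) : 0 < erfc a :=
  (erfc_nonneg' (a + 1)).trans_lt (erfc_strictAnti (by linarith))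

theorem erfc_eq' : erfc = fun b => 1 - (2 / Real.sqrt Real.pi) * ∫ t in (0:ℝ)..b, Real.exp (-t ^ 2) := by
  funext b
  have := aux_sub 0 b
  rw [erfc_zero'] at this
  linarith

theorem erfc_continuous : Continuous erfc := by
  rw [erfc_eq']
  have : Continuous fun b : ℝ => ∫ t in (0:ℝ)..b, Real.exp (-t ^ 2) :=
    intervalIntegral.continuous_primitive (fun _ _ => aux_integrable.intervalIntegrable) 0
  fun_prop

theorem erfc_tendsto : Tendsto erfc atTop (nhds 0) := by
  have h := intervalIntegral_tendsto_integral_Ioi (0:ℝ) aux_integrable.integrableOn tendsto_id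
  have h2 := (h.const_mul (2 / Real.sqrt Real.pi)).const_sub 1
  have e : (1:ℝ) - (2 / Real.sqrt Real.pi) * ∫ t in Set.Ioi (0:ℝ), Real.exp (-t ^ 2) = 0 := by
    have := erfc_zero'
    unfold erfc at this
    linarith
  rw [e] at h2
  rw [erfc_eq']
  exact h2

theorem erfc_surj (p : ℝ) (hp : 0 < p) (hp1 : p ≤ 1) : ∃ u, 0 ≤ u ∧ erfc u = p := by
  obtain ⟨b, hb, hb0⟩ :=
    ((erfc_tendsto.eventually (gt_mem_nhds hp)).and (eventually_ge_atTop 0)).exists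
  have := intermediate_value_Icc' hb0 erfc_continuous.continuousOn
  obtain ⟨u, hu, hu2⟩ := this ⟨hb.le, by rw [erfc_zero']; exact hp1⟩
  exact ⟨u, hu.1, hu2⟩

/-- One branch of the transformation. -/
noncomputable def ttfG (l u : ℝ) : ℝ := (1 / l) * ((erfc (u / Real.sqrt 2)) ^ (-l) - 1)

theorem ttfG_strictMono {l : ℝ} (hl : 0 < l) : StrictMono (ttfG l) := by
  intro a b hab
  unfold ttfG
  have h2 : 0 < Real.sqrt 2 := by positivity
  have h : erfc (b / Real.sqrt 2) < erfc (a / Real.sqrt 2) :=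
    erfc_strictAnti (div_lt_div_of_pos_right hab h2)
  have := Real.rpow_lt_rpow_of_neg (erfc_pos' _) h (neg_lt_zero.2 hl)
  exact mul_lt_mul_of_pos_left (by linarith) (by positivity)

theorem ttfG_zero (l : ℝ) : ttfG l 0 = 0 := by
  simp [ttfG, erfc_zero']

theorem ttfG_inv {l : ℝ} (hl : 0 < l) (u : ℝ) :
    (l * ttfG l u + 1) ^ (-(1 / l)) = erfc (u / Real.sqrt 2) := by
  have : l * ttfG l u + 1 = (erfc (u / Real.sqrt 2)) ^ (-l) := by
    unfold ttfG
    field_simp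
    ring
  rw [this, ← Real.rpow_mul (erfc_pos' _).le]
  have : -l * -(1 / l) = 1 := by field_simp
  rw [this, Real.rpow_one]

theorem ttfG_surj {l : ℝ} (hl : 0 < l) (y : ℝ) (hy : 0 ≤ y) : ∃ u, 0 ≤ u ∧ ttfG l u = y := by
  have h1 : 1 ≤ l * y + 1 := by nlinarith
  obtain ⟨u, hu, he⟩ := erfc_surj ((l * y + 1) ^ (-(1 / l))) (by positivity)
    (Real.rpow_le_one_of_one_le_of_nonpos h1 (by rw [neg_nonpos]; positivity))
  refine ⟨u * Real.sqrt 2, by positivity, ?_⟩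
  unfold ttfG
  have h2 : Real.sqrt 2 ≠ 0 := by positivity
  rw [mul_div_cancel_right₀ _ h2, he, ← Real.rpow_mul (by linarith)]
  have : -(1 / l) * -l = 1 := by field_simp
  rw [this, Real.rpow_one]
  field_simp
  ring

theorem ttfR_nonneg (m σ lp lm : ℝ) {z : ℝ} (hz : 0 ≤ z) :
    ttfR m σ lp lm z = m + σ * ttfG lp z := by
  simp only [ttfR, ttfG, if_pos hz, abs_of_nonneg hz]

theorem ttfR_neg (m σ lp lm : ℝ) {z : ℝ} (hz : z < 0) :
    ttfR m σ lp lm z = m - σ * ttfG lm (-z) := by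
  simp only [ttfR, ttfG, if_neg (not_le.2 hz), abs_of_neg hz]
  ring

theorem ttfR_bijective_and_inverse (m σ lp lm : ℝ) (hσ : 0 < σ) (hlp : 0 < lp)
    (hlm : 0 < lm) :
    StrictMono (ttfR m σ lp lm) ∧
    Function.Bijective (ttfR m σ lp lm) ∧
    ∀ x z : ℝ, ttfR m σ lp lm z = x →
      Real.sign z = Real.sign (x - m) ∧
      erfc (|z| / Real.sqrt 2)
        = ((if m ≤ x then lp else lm) * |(x - m) / σ| + 1)
            ^ (-(1 / (if m ≤ x then lp else lm))) := by
  have hGnn : ∀ {l : ℝ}, 0 < l → ∀ {u : ℝ}, 0 ≤ u → 0 ≤ ttfG l u := fun {l} hl {u} hu => by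
    rw [← ttfG_zero l]; exact (ttfG_strictMono hl).monotone hu
  have hGpos : ∀ {l : ℝ}, 0 < l → ∀ {u : ℝ}, 0 < u → 0 < ttfG l u := fun {l} hl {u} hu => by
    rw [← ttfG_zero l]; exact ttfG_strictMono hl hu
  have hmono : StrictMono (ttfR m σ lp lm) := by
    intro a b hab
    rcases le_or_gt 0 a with ha | ha
    · rw [ttfR_nonneg _ _ _ _ ha, ttfR_nonneg _ _ _ _ (ha.trans hab.le)]
      have := mul_lt_mul_of_pos_left (ttfG_strictMono hlp hab) hσ
      linarith
    · rw [ttfR_neg _ _ _ _ ha]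
      rcases le_or_gt 0 b with hb | hb
      · rw [ttfR_nonneg _ _ _ _ hb]
        have h1 := mul_pos hσ (hGpos hlm (neg_pos.2 ha))
        have h2 := mul_nonneg hσ.le (hGnn hlp hb)
        linarith
      · rw [ttfR_neg _ _ _ _ hb]
        have := mul_lt_mul_of_pos_left (ttfG_strictMono hlm (neg_lt_neg hab)) hσ
        linarith
  refine ⟨hmono, ⟨hmono.injective, ?_⟩, ?_⟩
  · intro x
    rcases le_or_gt m x with hx | hx
    · obtain ⟨u, hu, he⟩ := ttfG_surj hlp ((x - m) / σ) (div_nonneg (by linarith) hσ.le)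
      refine ⟨u, ?_⟩
      rw [ttfR_nonneg _ _ _ _ hu, he]
      field_simp
      ring
    · have hpos : 0 < (m - x) / σ := div_pos (by linarith) hσ
      obtain ⟨u, hu, he⟩ := ttfG_surj hlm ((m - x) / σ) hpos.le
      have hu' : 0 < u := by
        rcases hu.eq_or_lt with h | h
        · rw [← h, ttfG_zero] at he
          linarith
        · exact h
      refine ⟨-u, ?_⟩
      rw [ttfR_neg _ _ _ _ (neg_lt_zero.2 hu'), neg_neg, he]
      field_simp
      ring
  · intro x z hx
    have hσ' := hσ.ne'
    rcases le_or_gt 0 z with hz | hz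
    · rw [ttfR_nonneg _ _ _ _ hz] at hx
      have hg := hGnn hlp hz
      have hmx : m ≤ x := by
        have := mul_nonneg hσ.le hg
        linarith
      have e : (x - m) / σ = ttfG lp z := by
        rw [← hx]; field_simp; ring
      rw [if_pos hmx, e, abs_of_nonneg hg, abs_of_nonneg hz, ttfG_inv hlp]
      refine ⟨?_, rfl⟩
      rcases hz.eq_or_lt with h | h
      · rw [← h, ttfG_zero] at hx
        rw [← hx, ← h]
        simp
      · have := mul_pos hσ (hGpos hlp h)
        rw [Real.sign_of_pos h, Real.sign_of_pos (by linarith)]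
    · rw [ttfR_neg _ _ _ _ hz] at hx
      have hg := hGpos hlm (neg_pos.2 hz)
      have hmx : x < m := by
        have := mul_pos hσ hg
        linarith
      have e : (x - m) / σ = -ttfG lm (-z) := by
        rw [← hx]; field_simp; ring
      rw [if_neg (not_le.2 hmx), e, abs_neg, abs_of_pos hg, abs_of_neg hz, ttfG_inv hlm]
      exact ⟨by rw [Real.sign_of_neg hz, Real.sign_of_neg (by linarith)], rfl⟩
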